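/- arXiv:2506.10464 — 12 statements merged into one kernel-verified Lean document; each statement's English description precedes it below -/
import Mathlib

section
/- For every natural number n with n ≠ 6, every automorphism of the symmetric group Sym(n) is inner; that is, for every group automorphism φ of the group of permutations of an n-element set there exists a permutation g such that φ is conjugation by g. -/
open Equiv Equiv.Perm

lemma aux_fact (k : ℕ) : 2 ^ (k + 3) * (k + 4).factorial < (2 * k + 6).factorial := by
  induction k with
  | zero => decide
  | succ k ih =>
    have e1 : (2 * (k + 1) + 6).factorial = (2 * k + 8) * ((2 * k + 7) * (2 * k + 6).factorial) := by
      rw [show 2 * (k + 1) + 6 = (2 * k + 6) + 1 + 1 by ring, Nat.factorial_succ, Nat.factorial_succ]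
    have e2 : (k + 1 + 4).factorial = (k + 5) * (k + 4).factorial := by
      rw [show k + 1 + 4 = (k + 4) + 1 by ring, Nat.factorial_succ]
    rw [e1, e2]
    have h : 2 * (k + 5) ≤ (2 * k + 8) * (2 * k + 7) := by nlinarith
    calc 2 ^ (k + 1 + 3) * ((k + 5) * (k + 4).factorial)
        = (2 * (k + 5)) * (2 ^ (k + 3) * (k + 4).factorial) := by ring
      _ < (2 * (k + 5)) * (2 * k + 6).factorial := by gcongr
      _ ≤ ((2 * k + 8) * (2 * k + 7)) * (2 * k + 6).factorial := by gcongr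
      _ = _ := by ring

lemma aux_count (k m : ℕ) (hk : 1 ≤ k) (h6 : 2 * k + m ≠ 6)
    (h : m.factorial * (2 ^ k * k.factorial) = (2 * k + m - 2).factorial * 2) : k = 1 := by
  obtain rfl | rfl | rfl | h4 : k = 1 ∨ k = 2 ∨ k = 3 ∨ 4 ≤ k := by omega
  · rfl
  · exfalso
    rw [show 2 * 2 + m - 2 = m + 1 + 1 by omega, Nat.factorial_succ, Nat.factorial_succ] at h
    have hp := Nat.factorial_pos m
    have : (m + 2) * (m + 1) = 4 := by
      apply Nat.eq_of_mul_eq_mul_left hp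
      norm_num [Nat.factorial] at h
      linarith
    obtain rfl | rfl | h2 : m = 0 ∨ m = 1 ∨ 2 ≤ m := by omega
    · omega
    · omega
    · nlinarith
  · exfalso
    rw [show 2 * 3 + m - 2 = m + 1 + 1 + 1 + 1 by omega, Nat.factorial_succ, Nat.factorial_succ,
      Nat.factorial_succ, Nat.factorial_succ] at h
    have hp := Nat.factorial_pos m
    have : (m + 4) * ((m + 3) * ((m + 2) * (m + 1))) = 24 := by
      apply Nat.eq_of_mul_eq_mul_left hp
      norm_num [Nat.factorial] at h
      linarith
    have hm : 1 ≤ m := by omega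
    have : 5 * (4 * (3 * 2)) ≤ (m + 4) * ((m + 3) * ((m + 2) * (m + 1))) := by
      gcongr <;> omega
    omega
  · exfalso
    obtain ⟨j, rfl⟩ := Nat.exists_eq_add_of_le' h4
    have h1 := aux_fact j
    have h2 := Nat.factorial_mul_factorial_dvd_factorial_add (2 * j + 6) m
    have h3 := Nat.le_of_dvd (Nat.factorial_pos _) h2
    rw [show 2 * (j + 4) + m - 2 = 2 * j + 6 + m by omega] at h
    have hp := Nat.factorial_pos m
    have h5 : 2 ^ (j + 3) * (j + 4).factorial * m.factorial
      < (2 * j + 6).factorial * m.factorial := by gcongr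
    have h7 : m.factorial * (2 ^ (j + 4) * (j + 4).factorial)
      = 2 * (2 ^ (j + 3) * (j + 4).factorial * m.factorial) := by ring
    omega

lemma aux_cent {n : ℕ} (σ : Perm (Fin n)) (k : ℕ)
    (h : σ.cycleType = Multiset.replicate k 2) :
    Nat.card (Subgroup.centralizer {σ}) = (n - 2 * k).factorial * (2 ^ k * k.factorial) := by
  rw [Equiv.Perm.nat_card_centralizer, h]
  by_cases hk : k = 0
  · subst hk; simp
  · simp [Multiset.toFinset_replicate, hk, mul_comm k 2]
    try ring

lemma aux_cent_map {G : Type*} [Group G] (φ : MulAut G) (x : G) :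
    Nat.card (Subgroup.centralizer {φ x}) = Nat.card (Subgroup.centralizer {x}) := by
  symm
  refine Nat.card_congr (φ.toEquiv.subtypeEquiv ?_)
  intro y
  simp only [Subgroup.mem_centralizer_singleton_iff]
  simp [← map_mul]

lemma aux_isSwap {n : ℕ} (hn : n ≠ 6) (φ : MulAut (Perm (Fin n))) (τ : Perm (Fin n))
    (hτ : τ.IsSwap) : (φ τ).IsSwap := by
  have ho : orderOf (φ τ) = 2 := by
    rw [MulEquiv.orderOf_eq, hτ.orderOf]
  obtain ⟨k, hk⟩ := Equiv.Perm.cycleType_prime_order (σ := φ τ) (by rw [ho]; exact Nat.prime_two)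
  rw [ho] at hk
  have hc1 := aux_cent _ _ hk
  have ht : τ.cycleType = Multiset.replicate 1 2 := by
    rw [Equiv.Perm.IsCycle.cycleType hτ.isCycle, Equiv.Perm.card_support_eq_two.mpr hτ]; rfl
  have hc2 := aux_cent _ _ ht
  rw [aux_cent_map, hc2] at hc1
  have hle : 2 * (k + 1) ≤ n := by
    have := Equiv.Perm.sum_cycleType (φ τ)
    rw [hk] at this
    have h2 := Finset.card_le_univ (φ τ).support
    simp at this h2
    omega
  have := aux_count (k + 1) (n - 2 * (k + 1)) (by omega) (by omega) (by
    rw [← hc1, show 2 * (k + 1) + (n - 2 * (k + 1)) - 2 = n - 2 by omega]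
    simp)
  rw [this] at hk
  rw [← Equiv.Perm.card_support_eq_two, ← Equiv.Perm.sum_cycleType, hk]
  rfl

lemma aux_eq {α : Type*} [DecidableEq α] (T : Perm α) (hT : T.IsSwap) (a : α) (ha : T a ≠ a) :
    T = swap a (T a) := by
  obtain ⟨p, q, hpq, rfl⟩ := hT
  by_cases h1 : a = p
  · subst h1; simp
  by_cases h2 : a = q
  · subst h2; simp [swap_comm]
  · exact absurd (swap_apply_of_ne_of_ne h1 h2) ha

lemma aux_comm {α : Type*} [DecidableEq α] (T : Perm α) (a b : α) (ha : T a = a) (hb : T b = b) :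
    T * swap a b = swap a b * T := by
  have := Equiv.mul_swap_eq_swap_mul T a b
  rwa [ha, hb] at this

lemma aux_pair {α : Type*} [DecidableEq α] (T U : Perm α) (hT : T.IsSwap) (hU : U.IsSwap)
    (h : T * U ≠ U * T) : ∃ a b c, a ≠ b ∧ a ≠ c ∧ b ≠ c ∧ T = swap a b ∧ U = swap a c := by
  obtain ⟨p, q, hpq, rfl⟩ := hT
  by_cases hp : U p = p
  · by_cases hq : U q = q
    · exact absurd (aux_comm U p q hp hq).symm h
    · have e := aux_eq U hU q hq
      refine ⟨q, p, U q, hpq.symm, fun h => hq h.symm, ?_, swap_comm _ _, e⟩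
      intro h'
      rw [← h', swap_comm] at e
      exact h (by rw [e])
  · have e := aux_eq U hU p hp
    refine ⟨p, q, U p, hpq, fun h => hp h.symm, ?_, rfl, e⟩
    intro h'
    rw [← h'] at e
    exact h (by rw [e])

lemma aux_third {α : Type*} [DecidableEq α] (a b c : α) (hab : a ≠ b) (hac : a ≠ c)
    (hbc : b ≠ c) (T : Perm α) (hT : T.IsSwap)
    (h1 : T * swap a b ≠ swap a b * T) (h2 : T * swap a c ≠ swap a c * T)
    (h3 : T ≠ swap a b * swap a c * swap a b) : T a ≠ a := by
  intro ha
  have hb : T b ≠ b := fun hb => h1 (aux_comm T a b ha hb)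
  have hc : T c ≠ c := fun hc => h2 (aux_comm T a c ha hc)
  have e := aux_eq T hT b hb
  have : T b = c := by
    by_contra hne
    rw [e] at hc
    exact hc (swap_apply_of_ne_of_ne hbc.symm (Ne.symm hne))
  rw [this] at e
  apply h3
  rw [e, swap_comm a c, swap_mul_swap_mul_swap hac.symm hbc.symm]

lemma aux_nc {α : Type*} [DecidableEq α] (z x y : α) (hx : x ≠ z) (hy : y ≠ z) (hxy : x ≠ y) :
    swap z x * swap z y ≠ swap z y * swap z x := by
  intro h
  have := congrArg (fun f : Perm α => f z) h
  simp only [Perm.mul_apply, swap_apply_left] at this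
  rw [swap_apply_of_ne_of_ne hy hxy.symm, swap_apply_of_ne_of_ne hx hxy] at this
  exact hxy this.symm

lemma aux_tri {α : Type*} [DecidableEq α] (z x y : α) (hy : y ≠ z) (hxy : x ≠ y) :
    swap z x * swap z y * swap z x = swap x y := by
  rw [swap_comm z y, swap_mul_swap_mul_swap hy hxy.symm]

lemma aux_center {α : Type*} [DecidableEq α] (φ : MulAut (Perm α))
    (hφ : ∀ τ : Perm α, τ.IsSwap → (φ τ).IsSwap) (z : α) :
    ∃ a, ∀ x, x ≠ z → φ (swap z x) a ≠ a := by
  have hs : ∀ x, x ≠ z → (φ (swap z x)).IsSwap := fun x hx => hφ _ ⟨z, x, hx.symm, rfl⟩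
  have hnc : ∀ x y, x ≠ z → y ≠ z → x ≠ y →
      φ (swap z x) * φ (swap z y) ≠ φ (swap z y) * φ (swap z x) := by
    intro x y hx hy hxy h
    rw [← map_mul, ← map_mul] at h
    exact aux_nc z x y hx hy hxy (φ.injective h)
  by_cases h : ∃ x y, x ≠ z ∧ y ≠ z ∧ x ≠ y
  · obtain ⟨x, y, hx, hy, hxy⟩ := h
    obtain ⟨a, b, c, hab, hac, hbc, e1, e2⟩ := aux_pair _ _ (hs x hx) (hs y hy) (hnc x y hx hy hxy)
    refine ⟨a, fun w hw => ?_⟩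
    by_cases hwx : w = x
    · rw [hwx, e1, swap_apply_left]; exact hab.symm
    by_cases hwy : w = y
    · rw [hwy, e2, swap_apply_left]; exact hac.symm
    refine aux_third a b c hab hac hbc _ (hs w hw) ?_ ?_ ?_
    · rw [← e1]; exact hnc w x hw hx hwx
    · rw [← e2]; exact hnc w y hw hy hwy
    · rw [← e1, ← e2, ← map_mul, ← map_mul, aux_tri z x y hy hxy]
      intro h
      have := congrArg (fun f : Perm α => f z) (φ.injective h)
      simp only [swap_apply_left] at this
      rw [swap_apply_of_ne_of_ne hx.symm hy.symm] at this
      exact hw this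
  · by_cases h' : ∃ x, x ≠ z
    · obtain ⟨x, hx⟩ := h'
      obtain ⟨p, q, hpq, e⟩ := hs x hx
      refine ⟨p, fun w hw => ?_⟩
      have : w = x := by
        by_contra hne
        exact h ⟨w, x, hw, hx, hne⟩
      rw [this, e, swap_apply_left]
      exact hpq.symm
    · exact ⟨z, fun x hx => absurd ⟨x, hx⟩ h'⟩

lemma aux_main {α : Type*} [DecidableEq α] [Finite α] (φ : MulAut (Perm α))
    (hφ : ∀ τ : Perm α, τ.IsSwap → (φ τ).IsSwap) (z : α) :
    ∃ g : Perm α, ∀ x : Perm α, φ x = g * x * g⁻¹ := by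
  obtain ⟨a, ha⟩ := aux_center φ hφ z
  have key : ∀ x, φ (swap z x) = swap a (φ (swap z x) a) := by
    intro x
    by_cases hx : x = z
    · rw [hx, swap_self, ← Equiv.Perm.one_def, map_one]; simp [Equiv.Perm.one_def]
    · exact aux_eq _ (hφ _ ⟨z, x, Ne.symm hx, rfl⟩) a (ha x hx)
  have hinj : Function.Injective (fun x => φ (swap z x) a) := by
    intro x y hxy
    have h1 : φ (swap z x) = φ (swap z y) := by
      rw [key x, key y]; exact congrArg _ hxy
    have := congrArg (fun f : Perm α => f z) (φ.injective h1)
    simpa using this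
  let g : Perm α := Equiv.ofBijective _ (Finite.injective_iff_bijective.mp hinj)
  have hg : ∀ x, g x = φ (swap z x) a := fun x => rfl
  have hgz : g z = a := by
    rw [hg, swap_self, ← Equiv.Perm.one_def, map_one]; rfl
  have hz : ∀ x, φ (swap z x) = g * swap z x * g⁻¹ := by
    intro x
    rw [key x, Equiv.mul_swap_eq_swap_mul, hgz, hg, mul_inv_cancel_right]
  have heq : φ.toMonoidHom = (MulAut.conj g).toMonoidHom := by
    refine MonoidHom.eq_of_eqOn_dense (s := {σ : Perm α | σ.IsSwap}) Equiv.Perm.closure_isSwap ?_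
    rintro _ ⟨x, y, hxy, rfl⟩
    show φ (swap x y) = g * swap x y * g⁻¹
    by_cases hy : y = z
    · subst hy; rw [swap_comm]; exact hz x
    · rw [← aux_tri z x y hy hxy, map_mul, map_mul, hz, hz]
      group
  exact ⟨g, fun x => DFunLike.congr_fun heq x⟩

/-- For every natural number `n ≠ 6`, every automorphism of the symmetric group
`Sym(n)` (realized as `Equiv.Perm (Fin n)`) is inner. -/
theorem sym_aut_inner (n : ℕ) (hn : n ≠ 6) (φ : MulAut (Equiv.Perm (Fin n))) :
    ∃ g : Equiv.Perm (Fin n), ∀ x : Equiv.Perm (Fin n), φ x = g * x * g⁻¹ := by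
  rcases Nat.eq_zero_or_pos n with rfl | h
  · exact ⟨1, fun x => Subsingleton.elim _ _⟩
  · exact aux_main φ (fun τ hτ => aux_isSwap hn φ τ hτ) ⟨0, h⟩
end

section
/- For every integer n ≥ 3, the automorphism group of the dihedral group of order 2n is isomorphic to the holomorph of ℤ/nℤ, i.e., Aut(D_{2n}) ≅ (ℤ/nℤ) ⋊ (ℤ/nℤ)ˣ, where the unit group (ℤ/nℤ)ˣ acts on ℤ/nℤ by multiplication. -/
/-- The action of the unit group `(ℤ/nℤ)ˣ` on the (multiplicatively written) additive
group `ℤ/nℤ` by multiplication. -/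
def zmodUnitsAction (n : ℕ) : (ZMod n)ˣ →* MulAut (Multiplicative (ZMod n)) where
  toFun u := AddEquiv.toMultiplicative (DistribMulAction.toAddAut (ZMod n)ˣ (ZMod n) u)
  map_one' := by ext x; simp
  map_mul' u v := by ext x; simp [mul_smul]

open DihedralGroup in
/-- The affine map `r i ↦ r (u i)`, `sr i ↦ sr (u i + b)`. -/
def dihAffFun {n : ℕ} (b : ZMod n) (u : ZMod n) : DihedralGroup n → DihedralGroup n
  | r i => r (u * i)
  | sr i => sr (u * i + b)

open DihedralGroup in
/-- The affine automorphism. -/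
def dihAff {n : ℕ} (b : ZMod n) (u : (ZMod n)ˣ) : MulAut (DihedralGroup n) where
  toFun := dihAffFun b u
  invFun := dihAffFun (-((u⁻¹ : (ZMod n)ˣ) * b)) (u⁻¹ : (ZMod n)ˣ)
  left_inv := by rintro (i | i) <;> simp [dihAffFun, mul_add]
  right_inv := by rintro (i | i) <;> simp [dihAffFun, mul_add]
  map_mul' := by
    rintro (i | i) (j | j) <;> simp [dihAffFun] <;> ring

open DihedralGroup in
/-- The homomorphism from the holomorph to the automorphism group. -/
def dihHom (n : ℕ) : SemidirectProduct (Multiplicative (ZMod n)) (ZMod n)ˣ (zmodUnitsAction n) →*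
    MulAut (DihedralGroup n) where
  toFun x := dihAff x.left.toAdd x.right
  map_one' := by
    ext x; rcases x with i | i <;> simp [dihAff, dihAffFun]
  map_mul' x y := by
    ext z
    rcases z with i | i
    · simp [dihAff, dihAffFun, mul_assoc]
    · have hl : (x * y).left.toAdd = x.left.toAdd + (x.right : ZMod n) * y.left.toAdd := rfl
      have hr : (((x * y).right : (ZMod n)ˣ) : ZMod n) = x.right * y.right := rfl
      simp only [dihAff, dihAffFun, hl, hr, MulAut.mul_apply, MulEquiv.coe_mk, Equiv.coe_fn_mk,
        sr.injEq]
      ring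

open DihedralGroup in
theorem dih_map_r {n : ℕ} (hn : 3 ≤ n) (f : MulAut (DihedralGroup n)) :
    ∃ a : ZMod n, ∀ i, f (r i) = r (a * i) := by
  have ho : orderOf (f (r 1)) = n := by
    rw [MulEquiv.orderOf_eq, orderOf_r_one]
  rcases h : f (r 1) with a | a
  · refine ⟨a, fun i => ?_⟩
    obtain ⟨k, rfl⟩ := ZMod.intCast_surjective i
    rw [← r_one_zpow, map_zpow, h, r_zpow]
  · rw [h, orderOf_sr] at ho
    omega

open DihedralGroup in
theorem dihHom_bijective {n : ℕ} (hn : 3 ≤ n) : Function.Bijective (dihHom n) := by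
  constructor
  · intro x y h
    have h1 : dihHom n x (r 1) = dihHom n y (r 1) := by rw [h]
    have h2 : dihHom n x (sr 0) = dihHom n y (sr 0) := by rw [h]
    simp [dihHom, dihAff, dihAffFun] at h1 h2
    exact SemidirectProduct.ext h2 (Units.ext h1)
  · intro f
    obtain ⟨a, ha⟩ := dih_map_r hn f
    obtain ⟨c, hc⟩ := dih_map_r hn f⁻¹
    have hca : c * a = 1 := by
      have := MulAut.inv_apply_self _ f (r 1)
      rw [ha, hc] at this
      simpa using this
    rcases h : f (sr 0) with b | b
    · have := MulAut.inv_apply_self _ f (sr 0)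
      rw [h, hc] at this
      cases this
    · refine ⟨⟨Multiplicative.ofAdd b, ⟨a, c, by rw [mul_comm, hca], hca⟩⟩, ?_⟩
      ext z
      rcases z with i | i
      · simp [dihHom, dihAff, dihAffFun, ha]
      · have : (sr i : DihedralGroup n) = sr 0 * r i := by simp
        rw [this, map_mul f, h, ha]
        simp [dihHom, dihAff, dihAffFun, add_comm]

/-- For every `n ≥ 3`, `Aut(D_{2n}) ≅ (ℤ/nℤ) ⋊ (ℤ/nℤ)ˣ`, the holomorph of `ℤ/nℤ`. -/
theorem aut_dihedral_iso_holomorph (n : ℕ) (hn : 3 ≤ n) :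
    Nonempty (MulAut (DihedralGroup n) ≃*
      SemidirectProduct (Multiplicative (ZMod n)) (ZMod n)ˣ (zmodUnitsAction n)) := by
  exact ⟨(MulEquiv.ofBijective (dihHom n) (dihHom_bijective hn)).symm⟩
end

section
/- Let n > 3 be a natural number. For a permutation f of ℤ/nℤ the following are equivalent: (a) there exist a unit u of ℤ/nℤ and an element a of ℤ/nℤ such that f(x) = u·x + a for all x; (b) for all x, y ∈ ℤ/nℤ, x − y is a unit of ℤ/nℤ if and only if f(x) − f(y) is a unit, and for all x, y, z, w ∈ ℤ/nℤ with x − y and z − w units, one has (x − y = z − w or x − y = −(z − w)) if and only if (f(x) − f(y) = f(z) − f(w) or f(x) − f(y) = −(f(z) − f(w))). -/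
/-- For `n > 3`, a permutation `f` of `ℤ/nℤ` is of the form `x ↦ u·x + a` with `u` a unit
if and only if it is a correlation of the incidence system `Γ(D_{2n})`: it preserves the
property of a difference being a unit, and preserves equality of edge-colors
`{x − y, −(x − y)}`. -/
theorem affine_iff_correlation (n : ℕ) (hn : 3 < n) (f : Equiv.Perm (ZMod n)) :
    (∃ (u : (ZMod n)ˣ) (a : ZMod n), ∀ x : ZMod n, f x = (u : ZMod n) * x + a) ↔
      ((∀ x y : ZMod n, IsUnit (x - y) ↔ IsUnit (f x - f y)) ∧
        ∀ x y z w : ZMod n, IsUnit (x - y) → IsUnit (z - w) →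
          ((x - y = z - w ∨ x - y = -(z - w)) ↔
            (f x - f y = f z - f w ∨ f x - f y = -(f z - f w)))) := by
  haveI : NeZero n := ⟨by omega⟩
  have h2 : (2 : ZMod n) ≠ 0 := by
    intro h
    have h' : ((2 : ℕ) : ZMod n) = 0 := by exact_mod_cast h
    rw [ZMod.natCast_eq_zero_iff] at h'
    have := Nat.le_of_dvd (by norm_num) h'
    omega
  constructor
  · rintro ⟨u, a, h⟩
    have hd : ∀ x y, f x - f y = (u : ZMod n) * (x - y) := by
      intro x y
      rw [h, h]
      ring
    refine ⟨fun x y => ?_, fun x y z w _ _ => ?_⟩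
    · rw [hd, Units.isUnit_units_mul]
    · rw [hd, hd, ← mul_neg, Units.mul_right_inj, Units.mul_right_inj]
  · rintro ⟨h, hc⟩
    have hu : IsUnit (f 1 - f 0) := (h 1 0).1 (by simp)
    have hpm : ∀ x, f (x + 1) - f x = f 1 - f 0 ∨ f (x + 1) - f x = -(f 1 - f 0) := by
      intro x
      exact (hc (x + 1) x 1 0 (by simp) (by simp)).1 (Or.inl (by ring))
    have hne : ∀ x, f (x + 1 + 1) ≠ f x := by
      intro x hx
      have hx' := f.injective hx
      apply h2
      linear_combination hx'
    have key : ∀ k : ℕ, f ((k : ZMod n) + 1) - f k = f 1 - f 0 := by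
      intro k
      induction k with
      | zero => simp
      | succ k ih =>
        push_cast
        rcases hpm ((k : ZMod n) + 1) with h1 | h1
        · exact h1
        · exact absurd (by linear_combination h1 + ih) (hne k)
    have hall : ∀ k : ℕ, f (k : ZMod n) = (f 1 - f 0) * k + f 0 := by
      intro k
      induction k with
      | zero => simp
      | succ k ih =>
        have := key k
        push_cast
        linear_combination this + ih
    refine ⟨hu.unit, f 0, fun x => ?_⟩
    have := hall x.val
    rw [ZMod.natCast_zmod_val] at this
    simpa using this
end

section
/- Let n > 3 be a natural number. The set of permutations f of ℤ/nℤ such that (i) for all x, y, x − y is a unit of ℤ/nℤ if and only if f(x) − f(y) is a unit, and (ii) for all x, y, z, w with x − y and z − w units, (x − y = z − w or x − y = −(z − w)) if and only if (f(x) − f(y) = f(z) − f(w) or f(x) − f(y) = −(f(z) − f(w))), has exactly n·φ(n) elements, where φ is Euler's totient function. -/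
/-- The affine permutation `x ↦ u x + b`. -/
def affPerm {n : ℕ} (p : ZMod n × (ZMod n)ˣ) : Equiv.Perm (ZMod n) :=
  (Units.mulLeft p.2).trans (Equiv.addRight p.1)

theorem affPerm_apply {n : ℕ} (p : ZMod n × (ZMod n)ˣ) (x : ZMod n) :
    affPerm p x = p.2 * x + p.1 := rfl

theorem affPerm_sub {n : ℕ} (p : ZMod n × (ZMod n)ˣ) (x y : ZMod n) :
    affPerm p x - affPerm p y = p.2 * (x - y) := by
  rw [affPerm_apply, affPerm_apply]; ring

theorem exists_affPerm (n : ℕ) (hn : 3 < n) (f : Equiv.Perm (ZMod n))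
    (h1 : ∀ x y : ZMod n, IsUnit (x - y) ↔ IsUnit (f x - f y))
    (h2 : ∀ x y z w : ZMod n, IsUnit (x - y) → IsUnit (z - w) →
          ((x - y = z - w ∨ x - y = -(z - w)) ↔
            (f x - f y = f z - f w ∨ f x - f y = -(f z - f w)))) :
    ∃ p, affPerm p = f := by
  have : NeZero n := ⟨by omega⟩
  have two : (2 : ZMod n) ≠ 0 := by
    intro h
    have h' : ((2 : ℕ) : ZMod n) = 0 := by exact_mod_cast h
    rw [ZMod.natCast_eq_zero_iff] at h'
    have := Nat.le_of_dvd (by norm_num) h'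
    omega
  have hu : ∀ x : ZMod n, IsUnit (x + 1 - x) := fun x => by simp
  have step : ∀ x, f (x + 1 + 1) - f (x + 1) = f (x + 1) - f x := by
    intro x
    rcases (h2 (x + 1 + 1) (x + 1) (x + 1) x (hu _) (hu _)).1 (Or.inl (by ring)) with h | h
    · exact h
    · exfalso
      have h3 : f (x + 1 + 1) = f x := by linear_combination h
      have h4 := f.injective h3
      exact two (by linear_combination h4)
  obtain ⟨u, hu1⟩ := (h1 (0 + 1) 0).1 (hu 0)
  have key : ∀ k : ℕ, f ((k : ZMod n) + 1) - f k = u := by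
    intro k
    induction k with
    | zero => rw [hu1]; simp
    | succ k ih => push_cast; rw [step, ih]
  have key2 : ∀ k : ℕ, f (k : ZMod n) = u * k + f 0 := by
    intro k
    induction k with
    | zero => simp
    | succ k ih => push_cast; linear_combination key k + ih
  refine ⟨(f 0, u), Equiv.ext fun x => ?_⟩
  rw [affPerm_apply]
  have := key2 x.val
  rw [ZMod.natCast_zmod_val] at this
  exact this.symm

/-- For `n > 3`, the correlation group of the incidence system `Γ(D_{2n})` has order
`n·φ(n)`: there are exactly `n·φ(n)` permutations of `ℤ/nℤ` preserving unit differences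
and the edge-color classes `{x − y, −(x − y)}`. -/
theorem card_correlations_eq (n : ℕ) (hn : 3 < n) :
    Nat.card {f : Equiv.Perm (ZMod n) //
      (∀ x y : ZMod n, IsUnit (x - y) ↔ IsUnit (f x - f y)) ∧
        ∀ x y z w : ZMod n, IsUnit (x - y) → IsUnit (z - w) →
          ((x - y = z - w ∨ x - y = -(z - w)) ↔
            (f x - f y = f z - f w ∨ f x - f y = -(f z - f w)))} = n * Nat.totient n := by
  have : NeZero n := ⟨by omega⟩
  have hc : Nat.card (ZMod n × (ZMod n)ˣ) = n * Nat.totient n := by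
    rw [Nat.card_prod, Nat.card_zmod, Nat.card_eq_fintype_card, ZMod.card_units_eq_totient]
  rw [← hc]
  symm
  refine Nat.card_congr (Equiv.ofBijective (fun p => ⟨affPerm p, ?_, ?_⟩) ⟨?_, ?_⟩)
  · intro x y
    rw [affPerm_sub, Units.isUnit_units_mul]
  · intro x y z w _ _
    rw [affPerm_sub, affPerm_sub, ← mul_neg, Units.mul_right_inj, Units.mul_right_inj]
  · intro p q h
    have h' : affPerm p = affPerm q := congrArg Subtype.val h
    have h0 := DFunLike.congr_fun h' 0
    have h1 := DFunLike.congr_fun h' 1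
    simp only [affPerm_apply, mul_zero, zero_add, mul_one] at h0 h1
    refine Prod.ext h0 (Units.ext ?_)
    linear_combination h1 - h0
  · rintro ⟨f, h1, h2⟩
    obtain ⟨p, hp⟩ := exists_affPerm n hn f h1 h2
    exact ⟨p, Subtype.ext hp⟩
end

section
/- The automorphism group of the direct product Sym(4) × C₂ is isomorphic to Sym(4) × C₂ itself; that is, MulAut (Equiv.Perm (Fin 4) × C₂) ≃* Equiv.Perm (Fin 4) × C₂. -/
/-- The cyclic group of order 2. -/
abbrev C₂ : Type := Multiplicative (ZMod 2)

open Equiv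

lemma cTwo_sq (c : C₂) : c * c = 1 := by revert c; decide

/-- The central twist: trivial on even permutations and `c` on odd ones. -/
def chi (c : C₂) (x : Perm (Fin 4)) : C₂ := if Perm.sign x = 1 then 1 else c

lemma chi_mul (c : C₂) (x y : Perm (Fin 4)) : chi c (x * y) = chi c x * chi c y := by
  unfold chi
  rw [Perm.sign_mul]
  rcases Int.units_eq_one_or (Perm.sign x) with h | h <;>
  rcases Int.units_eq_one_or (Perm.sign y) with h' | h' <;> simp [h, h', cTwo_sq]

lemma chi_conj (c : C₂) (g x : Perm (Fin 4)) : chi c (g * x * g⁻¹) = chi c x := by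
  unfold chi
  rw [Perm.sign_mul, Perm.sign_mul, mul_right_comm, Perm.sign_inv, Int.units_mul_self, one_mul]

lemma chi_mul_left (c d : C₂) (x : Perm (Fin 4)) : chi (c * d) x = chi c x * chi d x := by
  unfold chi; split_ifs <;> simp

lemma chi_one (x : Perm (Fin 4)) : chi 1 x = 1 := by
  unfold chi; split_ifs <;> rfl

/-- The endomorphism attached to an element of `Sym(4) × C₂`. -/
def phiEnd : Perm (Fin 4) × C₂ →* Monoid.End (Perm (Fin 4) × C₂) where
  toFun p :=
    { toFun := fun x => (p.1 * x.1 * p.1⁻¹, x.2 * chi p.2 x.1)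
      map_one' := by ext1 <;> simp [chi]
      map_mul' := fun x y => by
        ext1
        · simp [mul_assoc]
        · simp only [Prod.snd_mul, Prod.fst_mul, chi_mul]
          exact mul_mul_mul_comm _ _ _ _ }
  map_one' := by
    apply MonoidHom.ext; intro x
    change ((1 : Perm (Fin 4)) * x.1 * 1⁻¹, x.2 * chi 1 x.1) = x
    simp [chi_one]
  map_mul' p q := by
    apply MonoidHom.ext; intro x
    change ((p.1 * q.1) * x.1 * (p.1 * q.1)⁻¹, x.2 * chi (p.2 * q.2) x.1) =
      (p.1 * (q.1 * x.1 * q.1⁻¹) * p.1⁻¹, x.2 * chi q.2 x.1 * chi p.2 (q.1 * x.1 * q.1⁻¹))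
    rw [chi_conj, chi_mul_left, mul_assoc x.2, mul_comm (chi q.2 x.1)]
    simp [mul_assoc]

/-- The automorphism attached to an element of `Sym(4) × C₂`. -/
def phi : Perm (Fin 4) × C₂ →* MulAut (Perm (Fin 4) × C₂) where
  toFun p := MonoidHom.toMulEquiv (phiEnd p) (phiEnd p⁻¹)
    (by change phiEnd p⁻¹ * phiEnd p = 1; rw [← map_mul]; simp)
    (by change phiEnd p * phiEnd p⁻¹ = 1; rw [← map_mul]; simp)
  map_one' := by
    apply MulEquiv.ext; intro x
    change phiEnd 1 x = x
    rw [map_one]; rfl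
  map_mul' p q := by
    apply MulEquiv.ext; intro x
    change phiEnd (p * q) x = phiEnd p (phiEnd q x)
    rw [map_mul]; rfl

lemma phi_apply (p x : Perm (Fin 4) × C₂) :
    phi p x = (p.1 * x.1 * p.1⁻¹, x.2 * chi p.2 x.1) := rfl

lemma center_triv : ∀ y : Perm (Fin 4), (∀ g : Perm (Fin 4), g * y = y * g) → y = 1 := by
  decide +kernel

set_option synthInstance.maxHeartbeats 400000 in
set_option synthInstance.maxSize 4000 in
lemma inner_key : ∀ r : Perm (Fin 4), r ^ 4 = 1 → r ^ 2 ≠ 1 → ∀ a : Perm (Fin 4),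
    a ^ 2 = 1 → (a * r) ^ 3 = 1 →
    ∃ g : Perm (Fin 4), g * swap 0 1 * g⁻¹ = a ∧ g * finRotate 4 * g⁻¹ = r := by
  decide +kernel

lemma cTwo_key : ∀ s t : C₂, (s * t) ^ 3 = 1 → s = t := by decide

lemma gen_top : Subgroup.closure {finRotate 4, swap (0 : Fin 4) 1} = ⊤ := by
  have := Perm.closure_cycle_adjacent_swap (σ := finRotate 4) isCycle_finRotate
    support_finRotate 0
  simpa using this

lemma phi_injective : Function.Injective phi := by
  rw [injective_iff_map_eq_one]
  rintro ⟨g, c⟩ h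
  have h1 : ∀ x, phi (g, c) x = x := fun x => by rw [h]; rfl
  have hg : g = 1 := by
    apply center_triv
    intro x
    have := congrArg Prod.fst (h1 (x, 1))
    simp only [phi_apply] at this
    exact (mul_inv_eq_iff_eq_mul.mp this).symm
  have hc : c = 1 := by
    have := congrArg Prod.snd (h1 (swap 0 1, 1))
    simpa [phi_apply, chi] using this
  rw [hg, hc]; rfl

lemma phi_surjective : Function.Surjective phi := by
  intro α
  have hz : ∀ c : C₂, α (1, c) = (1, c) := by
    have h1 : ∀ c : C₂, (α (1, c)).1 = 1 := by
      intro c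
      apply center_triv
      intro g
      obtain ⟨x, hx⟩ := α.surjective (g, 1)
      have : α (x * (1, c)) = α ((1, c) * x) := by
        congr 1
        ext1
        · simp
        · exact mul_comm _ _
      rw [map_mul, map_mul, hx] at this
      exact congrArg Prod.fst this
    intro c
    ext1
    · exact h1 c
    · have hc : c = 1 ∨ c = Multiplicative.ofAdd 1 := by revert c; decide
      rcases hc with rfl | rfl
      · have : α ((1 : Perm (Fin 4)), (1 : C₂)) = 1 := map_one α
        rw [this]; rfl
      · have hd : ∀ d : C₂, d ≠ 1 → d = Multiplicative.ofAdd 1 := by decide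
        apply hd
        intro h
        have h2 : α (1, Multiplicative.ofAdd 1) = 1 := Prod.ext (h1 _) h
        rw [map_eq_one_iff α α.injective] at h2
        exact absurd (congrArg Prod.snd h2) (by decide)
  let β : Perm (Fin 4) →* Perm (Fin 4) × C₂ := α.toMonoidHom.comp (MonoidHom.inl _ _)
  have hβ : ∀ x, β x = α (x, 1) := fun _ => rfl
  have ea : (swap (0 : Fin 4) 1) ^ 2 = 1 := by decide
  have er : (finRotate 4) ^ 4 = 1 := by decide
  have ear : (swap (0 : Fin 4) 1 * finRotate 4) ^ 3 = 1 := by decide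
  have er2 : (finRotate 4) ^ 2 ≠ 1 := by decide
  have ha := congrArg β ea
  have hr := congrArg β er
  have har := congrArg β ear
  rw [map_one, map_pow] at ha hr har
  rw [map_mul] at har
  have hr2 : (β (finRotate 4)).1 ^ 2 ≠ 1 := by
    intro h
    have h2 : β (finRotate 4 ^ 2) = 1 := by
      rw [map_pow]
      refine Prod.ext h ?_
      rw [Prod.pow_snd, pow_two, cTwo_sq]; rfl
    rw [hβ, map_eq_one_iff α α.injective] at h2
    exact er2 (congrArg Prod.fst h2)
  obtain ⟨g, hg1, hg2⟩ := inner_key _ (congrArg Prod.fst hr) hr2 _ (congrArg Prod.fst ha)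
    (congrArg Prod.fst har)
  have hs := cTwo_key _ _ (congrArg Prod.snd har)
  refine ⟨(g, (β (swap 0 1)).2), ?_⟩
  have key : (phi (g, (β (swap 0 1)).2)).toMonoidHom.comp (MonoidHom.inl _ _) = β := by
    apply MonoidHom.eq_of_eqOn_dense gen_top
    rintro x (rfl | rfl)
    · change phi _ (finRotate 4, 1) = _
      rw [phi_apply]
      refine Prod.ext hg2 ?_
      rw [← hs]
      simp [chi, sign_finRotate]
      intro h
      exact absurd h (by decide)
    · change phi _ (swap 0 1, 1) = _
      rw [phi_apply]
      refine Prod.ext hg1 ?_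
      simp [chi]
  apply MulEquiv.ext
  rintro ⟨x, c⟩
  have hx : ((x, c) : Perm (Fin 4) × C₂) = (x, 1) * (1, c) := by simp
  have h1 : phi (g, (β (swap 0 1)).2) (x, 1) = α (x, 1) := DFunLike.congr_fun key x
  have h2 : phi (g, (β (swap 0 1)).2) (1, c) = (1, c) := by
    rw [phi_apply]
    simp [chi]
  rw [hx, map_mul, map_mul, hz, h1, h2]

/-- The automorphism group of `Sym(4) × C₂` (the automorphism group of the cube)
is isomorphic to `Sym(4) × C₂` itself. -/
theorem mulAut_symFour_prod_cTwo :
    Nonempty (MulAut (Equiv.Perm (Fin 4) × C₂) ≃* Equiv.Perm (Fin 4) × C₂) := by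
  exact ⟨(MulEquiv.ofBijective phi ⟨phi_injective, phi_surjective⟩).symm⟩
end

section
/- The automorphism group of the direct product A₅ × C₂ is isomorphic to Sym(5); that is, MulAut (alternatingGroup (Fin 5) × C₂) ≃* Equiv.Perm (Fin 5). -/
/-- A product of two disjoint transpositions. -/
def permA : Equiv.Perm (Fin 5) := Equiv.swap 0 3 * Equiv.swap 1 4

/-- A 3-cycle. -/
def permB : Equiv.Perm (Fin 5) := Equiv.swap 0 1 * Equiv.swap 1 2

lemma exists_conj_permB : ∀ y : Equiv.Perm (Fin 5), y ^ 3 = 1 → y ≠ 1 →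
    ∃ s : Equiv.Perm (Fin 5), s * permB * s⁻¹ = y := by
  decide +kernel

lemma exists_conj_permA : ∀ x : Equiv.Perm (Fin 5), x ^ 2 = 1 → x ≠ 1 → (x * permB) ^ 5 = 1 →
    ∃ s : Equiv.Perm (Fin 5), s * permA * s⁻¹ = x ∧ s * permB * s⁻¹ = permB := by
  decide +kernel

/-- `permA` as an element of the alternating group. -/
def altA : alternatingGroup (Fin 5) := ⟨permA, by
  rw [Equiv.Perm.mem_alternatingGroup]; decide +kernel⟩

/-- `permB` as an element of the alternating group. -/
def altB : alternatingGroup (Fin 5) := ⟨permB, by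
  rw [Equiv.Perm.mem_alternatingGroup]; decide +kernel⟩

lemma altA_sq : altA ^ 2 = 1 := Subtype.ext (by decide +kernel : permA ^ 2 = 1)
lemma altB_cube : altB ^ 3 = 1 := Subtype.ext (by decide +kernel : permB ^ 3 = 1)
lemma altAB_pow : (altA * altB) ^ 5 = 1 := Subtype.ext (by decide +kernel : (permA * permB) ^ 5 = 1)
lemma altA_ne : altA ≠ 1 := fun h => (by decide +kernel : permA ≠ 1) (congrArg Subtype.val h)
lemma altB_ne : altB ≠ 1 := fun h => (by decide +kernel : permB ≠ 1) (congrArg Subtype.val h)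
lemma altAB_ne : altA * altB ≠ 1 :=
  fun h => (by decide +kernel : permA * permB ≠ 1) (congrArg Subtype.val h)

/-- The elements `altA` and `altB` generate `A₅`. -/
lemma eq_top_of_mem (H : Subgroup (alternatingGroup (Fin 5))) (ha : altA ∈ H) (hb : altB ∈ H) :
    H = ⊤ := by
  have hcard : Nat.card (alternatingGroup (Fin 5)) = 60 := by
    rw [nat_card_alternatingGroup]; simp [Nat.factorial]
  have key : ∀ (g : alternatingGroup (Fin 5)) (p : ℕ), p.Prime → g ∈ H → g ^ p = 1 → g ≠ 1 →
      p ∣ Nat.card H := by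
    intro g p hp hg h1 h2
    have := Fact.mk hp
    rw [← orderOf_eq_prime h1 h2]
    exact Subgroup.orderOf_dvd_natCard H hg
  have h2 := key _ 2 (by norm_num) ha altA_sq altA_ne
  have h3 := key _ 3 (by norm_num) hb altB_cube altB_ne
  have h5 := key _ 5 (by norm_num) (H.mul_mem ha hb) altAB_pow altAB_ne
  have hm := H.card_mul_index
  rw [hcard] at hm
  have h30 : 30 ∣ Nat.card H := by omega
  obtain ⟨k, hk⟩ := h30
  rw [hk] at hm
  have hk2 : k * H.index = 2 := by nlinarith
  have hidx : H.index ∣ 2 := Dvd.intro_left k hk2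
  rcases (Nat.dvd_prime Nat.prime_two).1 hidx with h | h
  · exact Subgroup.index_eq_one.1 h
  · have := Subgroup.normal_of_index_eq_two h
    have : IsSimpleGroup (alternatingGroup (Fin 5)) :=
      alternatingGroup.isSimpleGroup (by simp)
    rcases IsSimpleGroup.eq_bot_or_eq_top_of_normal H inferInstance with h' | h'
    · rw [h'] at ha
      exact absurd (Subgroup.mem_bot.1 ha) altA_ne
    · exact h'

/-- Every injective endomorphism of `A₅` is conjugation by a permutation. -/
lemma exists_conj (f : alternatingGroup (Fin 5) →* alternatingGroup (Fin 5))
    (hf : Function.Injective f) :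
    ∃ s : Equiv.Perm (Fin 5), ∀ g, f g = MulAut.conjNormal s g := by
  have cv : ∀ (g : alternatingGroup (Fin 5)) (n : ℕ), g ^ n = 1 →
      (f g : Equiv.Perm (Fin 5)) ^ n = 1 := by
    intro g n h
    rw [← Subgroup.coe_pow, ← map_pow, h, map_one, Subgroup.coe_one]
  have cn : ∀ g : alternatingGroup (Fin 5), g ≠ 1 → (f g : Equiv.Perm (Fin 5)) ≠ 1 := by
    intro g h h'
    exact h (hf (by rw [map_one]; exact Subtype.ext h'))
  obtain ⟨s, hs⟩ := exists_conj_permB _ (cv _ 3 altB_cube) (cn _ altB_ne)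
  have hAB := cv _ 5 altAB_pow
  rw [map_mul, Subgroup.coe_mul] at hAB
  have e1 : ∀ x y : Equiv.Perm (Fin 5), ∀ n : ℕ, x ^ n = 1 → (y * x * y⁻¹) ^ n = 1 := by
    intro x y n h
    rw [conj_pow, h]; simp
  obtain ⟨t, ht1, ht2⟩ := exists_conj_permA (s⁻¹ * (f altA : Equiv.Perm (Fin 5)) * s)
    (by simpa using e1 _ s⁻¹ 2 (cv _ 2 altA_sq))
    (by
      intro h
      apply cn _ altA_ne
      have : (f altA : Equiv.Perm (Fin 5)) = s * (s⁻¹ * (f altA : Equiv.Perm (Fin 5)) * s) * s⁻¹ := by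
        group
      rw [this, h]; simp)
    (by
      have := e1 _ s⁻¹ 5 hAB
      rw [← hs] at this
      convert this using 2
      group)
  refine ⟨s * t, fun g => ?_⟩
  have hE := eq_top_of_mem (f.eqLocus (MulAut.conjNormal (s * t)).toMonoidHom)
    (by
      apply Subtype.ext
      change (f altA : Equiv.Perm (Fin 5)) = (s * t) * permA * (s * t)⁻¹
      have : (s * t) * permA * (s * t)⁻¹ = s * (t * permA * t⁻¹) * s⁻¹ := by group
      rw [this, ht1]; group)
    (by
      apply Subtype.ext
      change (f altB : Equiv.Perm (Fin 5)) = (s * t) * permB * (s * t)⁻¹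
      have : (s * t) * permB * (s * t)⁻¹ = s * (t * permB * t⁻¹) * s⁻¹ := by group
      rw [this, ht2, hs])
  have : g ∈ f.eqLocus (MulAut.conjNormal (s * t)).toMonoidHom := by rw [hE]; trivial
  exact this

/-- Homomorphisms from `A₅` to `C₂` are trivial. -/
lemma hom_trivial (f : alternatingGroup (Fin 5) →* C₂) (g : alternatingGroup (Fin 5)) :
    f g = 1 := by
  have c2 : ∀ c : C₂, c ^ 2 = 1 := by decide
  have hb : f altB = 1 := by
    have h3 : f altB ^ 3 = 1 := by rw [← map_pow, altB_cube, map_one]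
    rwa [pow_succ, c2, one_mul] at h3
  have hab : f (altA * altB) = 1 := by
    have h5 : f (altA * altB) ^ 5 = 1 := by rw [← map_pow, altAB_pow, map_one]
    have c5 : ∀ c : C₂, c ^ 5 = 1 → c = 1 := by decide
    exact c5 _ h5
  have ha : f altA = 1 := by rwa [map_mul, hb, mul_one] at hab
  have hE := eq_top_of_mem f.ker ha hb
  have : g ∈ f.ker := by rw [hE]; trivial
  exact this

/-- The action of `Sym(5)` on `A₅ × C₂` by conjugation on the first factor. -/
def conjProd : Equiv.Perm (Fin 5) →* MulAut (alternatingGroup (Fin 5) × C₂) where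
  toFun s := MulEquiv.prodCongr (MulAut.conjNormal s) (MulEquiv.refl C₂)
  map_one' := by rw [map_one]; rfl
  map_mul' s t := by rw [map_mul]; rfl

lemma conjProd_apply (s : Equiv.Perm (Fin 5)) (x : alternatingGroup (Fin 5) × C₂) :
    conjProd s x = (MulAut.conjNormal s x.1, x.2) := rfl

lemma centralizer_trivial : ∀ s : Equiv.Perm (Fin 5), s * permA * s⁻¹ = permA →
    s * permB * s⁻¹ = permB → s = 1 := by
  decide +kernel

lemma conjProd_injective : Function.Injective conjProd := by
  rw [injective_iff_map_eq_one]
  intro s hs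
  have h : ∀ g : alternatingGroup (Fin 5), MulAut.conjNormal s g = g := by
    intro g
    have := DFunLike.congr_fun hs (g, 1)
    rw [conjProd_apply] at this
    exact congrArg Prod.fst this
  exact centralizer_trivial s (congrArg Subtype.val (h altA)) (congrArg Subtype.val (h altB))

lemma conjProd_surjective : Function.Surjective conjProd := by
  intro φ
  have h2 : ∀ g, (φ (g, 1)).2 = 1 := fun g =>
    hom_trivial ((MonoidHom.snd _ _).comp (φ.toMonoidHom.comp (MonoidHom.inl _ _))) g
  let f : alternatingGroup (Fin 5) →* alternatingGroup (Fin 5) :=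
    (MonoidHom.fst _ _).comp (φ.toMonoidHom.comp (MonoidHom.inl _ C₂))
  have hfv : ∀ g, f g = (φ (g, 1)).1 := fun g => rfl
  have hf : Function.Injective f := by
    intro g g' h
    have : φ (g, 1) = φ (g', 1) := Prod.ext h ((h2 g).trans (h2 g').symm)
    exact congrArg Prod.fst (φ.injective this)
  have hc1 : ∀ c : C₂, (φ (1, c)).1 = 1 := by
    intro c
    have hmem : (φ (1, c)).1 ∈ Subgroup.center (alternatingGroup (Fin 5)) := by
      rw [Subgroup.mem_center_iff]
      intro g
      obtain ⟨⟨a, d⟩, hx⟩ := φ.surjective (g, 1)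
      have : φ (a, d) * φ (1, c) = φ (1, c) * φ (a, d) := by
        rw [← map_mul, ← map_mul]
        congr 1
        exact Prod.ext (by simp) (mul_comm _ _)
      rw [hx] at this
      exact congrArg Prod.fst this
    rw [alternatingGroup.center_eq_bot (by simp)] at hmem
    exact Subgroup.mem_bot.1 hmem
  have hc2 : ∀ c : C₂, (φ (1, c)).2 = c := by
    intro c
    have two : ∀ c d : C₂, (c = 1 ↔ d = 1) → d = c := by decide
    apply two
    constructor
    · rintro rfl
      change (φ 1).2 = 1
      rw [map_one]; rfl
    · intro h
      have : φ (1, c) = φ 1 := by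
        rw [map_one]; exact Prod.ext (hc1 c) h
      exact congrArg Prod.snd (φ.injective this)
  obtain ⟨s, hs⟩ := exists_conj f hf
  refine ⟨s, MulEquiv.ext fun x => ?_⟩
  obtain ⟨g, c⟩ := x
  have : φ (g, c) = φ (g, 1) * φ (1, c) := by
    rw [← map_mul]; simp
  rw [conjProd_apply, this]
  refine Prod.ext ?_ ?_
  · change MulAut.conjNormal s g = (φ (g, 1)).1 * (φ (1, c)).1
    rw [hc1, mul_one, ← hs, hfv]
  · change c = (φ (g, 1)).2 * (φ (1, c)).2
    rw [h2, hc2, one_mul]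

/-- The automorphism group of `A₅ × C₂` (the automorphism group of the dodecahedron)
is isomorphic to `Sym(5)`. -/
theorem mulAut_altFive_prod_cTwo :
    Nonempty (MulAut (alternatingGroup (Fin 5) × C₂) ≃* Equiv.Perm (Fin 5)) :=
  ⟨(MulEquiv.ofBijective conjProd ⟨conjProd_injective, conjProd_surjective⟩).symm⟩
end

section
/- The automorphism group of the alternating group A₅ is isomorphic to Sym(5); that is, MulAut (alternatingGroup (Fin 5)) ≃* Equiv.Perm (Fin 5). -/
namespace AltFiveAut

open Equiv

/-- A double transposition. -/
def pa : Perm (Fin 5) := swap 0 1 * swap 2 3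

/-- A three-cycle such that `pa * pb` is a five-cycle. -/
def pb : Perm (Fin 5) := swap 0 2 * swap 2 4

def a : alternatingGroup (Fin 5) := ⟨pa, by rw [Equiv.Perm.mem_alternatingGroup]; decide +kernel⟩

def b : alternatingGroup (Fin 5) := ⟨pb, by rw [Equiv.Perm.mem_alternatingGroup]; decide +kernel⟩

lemma pa_sq : pa ^ 2 = 1 := by decide +kernel
lemma pa_ne : pa ≠ 1 := by decide +kernel
lemma pb_cube : pb ^ 3 = 1 := by decide +kernel
lemma pb_ne : pb ≠ 1 := by decide +kernel
lemma pab_five : (pa * pb) ^ 5 = 1 := by decide +kernel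
lemma pab_ne : pa * pb ≠ 1 := by decide +kernel

lemma conj_involution : ∀ x : Perm (Fin 5), x ^ 2 = 1 → x ≠ 1 → Perm.sign x = 1 →
    ∃ g : Perm (Fin 5), g * pa = x * g := by decide +kernel

lemma conj_three : ∀ y : Perm (Fin 5), y ^ 3 = 1 → y ≠ 1 → (pa * y) ^ 5 = 1 →
    ∃ g : Perm (Fin 5), g * pa = pa * g ∧ g * pb = y * g := by decide +kernel

lemma centralizer_trivial : ∀ g : Perm (Fin 5), g * pa = pa * g → g * pb = pb * g → g = 1 := by
  decide +kernel

lemma conj_pair (x y : Perm (Fin 5)) (hs : Perm.sign x = 1) (hx : x ^ 2 = 1) (hx1 : x ≠ 1)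
    (hy : y ^ 3 = 1) (hy1 : y ≠ 1) (hxy : (x * y) ^ 5 = 1) :
    ∃ g : Perm (Fin 5), g * pa * g⁻¹ = x ∧ g * pb * g⁻¹ = y := by
  obtain ⟨g, hg⟩ := conj_involution x hx hx1 hs
  have hx' : x = g * pa * g⁻¹ := by rw [hg]; group
  obtain ⟨k, hk1, hk2⟩ := conj_three (g⁻¹ * y * g)
    (by
      have := conj_pow (i := 3) (a := g⁻¹) (b := y)
      rw [inv_inv] at this
      rw [this, hy]; group)
    (by
      intro h
      apply hy1
      have : y = g * (g⁻¹ * y * g) * g⁻¹ := by group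
      rw [this, h]; group)
    (by
      have h1 : pa * (g⁻¹ * y * g) = g⁻¹ * (x * y) * g := by rw [hx']; group
      have := conj_pow (i := 5) (a := g⁻¹) (b := x * y)
      rw [inv_inv] at this
      rw [h1, this, hxy]; group)
  refine ⟨g * k, ?_, ?_⟩
  · calc g * k * pa * (g * k)⁻¹ = g * (k * pa) * k⁻¹ * g⁻¹ := by group
      _ = x := by rw [hk1, hx']; group
  · calc g * k * pb * (g * k)⁻¹ = g * (k * pb) * k⁻¹ * g⁻¹ := by group
      _ = y := by rw [hk2]; group

lemma subgroup_eq_top (H : Subgroup (alternatingGroup (Fin 5))) (ha : a ∈ H) (hb : b ∈ H) :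
    H = ⊤ := by
  have key : ∀ (p : ℕ) (z : alternatingGroup (Fin 5)), p.Prime → z ∈ H →
      (z : Perm (Fin 5)) ^ p = 1 → (z : Perm (Fin 5)) ≠ 1 → p ∣ Nat.card H := by
    intro p z hp hz h1 h2
    haveI := Fact.mk hp
    have : orderOf z = p := by
      apply orderOf_eq_prime
      · exact Subtype.ext h1
      · intro h
        exact h2 (congrArg Subtype.val h)
    rw [← this]
    exact Subgroup.orderOf_dvd_natCard H hz
  have h2 := key 2 a (by norm_num) ha pa_sq pa_ne
  have h3 := key 3 b (by norm_num) hb pb_cube pb_ne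
  have h5 := key 5 (a * b) (by norm_num) (H.mul_mem ha hb) pab_five pab_ne
  have hcard : Nat.card (alternatingGroup (Fin 5)) = 60 := by
    rw [nat_card_alternatingGroup]; simp [Nat.factorial]
  have hmul := H.card_mul_index
  rw [hcard] at hmul
  have h30 : 30 ∣ Nat.card H := by omega
  obtain ⟨c, hc⟩ := h30
  rw [hc] at hmul
  have hci : c * H.index = 2 := by
    have : 30 * (c * H.index) = 30 * 2 := by rw [← mul_assoc, hmul]
    omega
  have hdvd : H.index ∣ 2 := ⟨c, by rw [← hci, mul_comm]⟩
  rcases (Nat.dvd_prime Nat.prime_two).1 hdvd with h | h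
  · exact Subgroup.index_eq_one.1 h
  · haveI := Subgroup.normal_of_index_eq_two h
    haveI : IsSimpleGroup (alternatingGroup (Fin 5)) := alternatingGroup.isSimpleGroup_five
    rcases IsSimpleGroup.eq_bot_or_eq_top_of_normal H inferInstance with h' | h'
    · rw [h', Subgroup.mem_bot] at ha
      exact absurd (congrArg Subtype.val ha) pa_ne
    · exact h'

lemma conj_bijective :
    Function.Bijective (MulAut.conjNormal :
      Perm (Fin 5) →* MulAut (alternatingGroup (Fin 5))) := by
  constructor
  · rw [injective_iff_map_eq_one]
    intro g hg
    have h : ∀ z : alternatingGroup (Fin 5), g * z = z * g := by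
      intro z
      have h1 := MulAut.conjNormal_apply g z
      rw [hg] at h1
      exact (eq_mul_inv_iff_mul_eq.1 h1).symm
    exact centralizer_trivial g (h a) (h b)
  · intro φ
    have hne : ∀ z : alternatingGroup (Fin 5), (z : Perm (Fin 5)) ≠ 1 →
        (φ z : Perm (Fin 5)) ≠ 1 := by
      intro z hz h
      have h1 : φ z = 1 := Subtype.ext h
      rw [map_eq_one_iff φ φ.injective] at h1
      exact hz (congrArg Subtype.val h1)
    have hpow : ∀ (z : alternatingGroup (Fin 5)) (n : ℕ), (z : Perm (Fin 5)) ^ n = 1 →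
        (φ z : Perm (Fin 5)) ^ n = 1 := by
      intro z n hz
      have h1 : z ^ n = 1 := Subtype.ext hz
      have h2 : φ z ^ n = 1 := by rw [← map_pow, h1, map_one]
      exact congrArg Subtype.val h2
    obtain ⟨g, hga, hgb⟩ := conj_pair (φ a) (φ b) (Equiv.Perm.mem_alternatingGroup.1 (φ a).2)
      (hpow a 2 pa_sq) (hne a pa_ne) (hpow b 3 pb_cube) (hne b pb_ne)
      (by
        have := hpow (a * b) 5 pab_five
        rwa [map_mul] at this)
    refine ⟨g, ?_⟩
    have htop := subgroup_eq_top
      ((MulAut.conjNormal g : MulAut (alternatingGroup (Fin 5))).toMonoidHom.eqLocus φ.toMonoidHom)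
      (Subtype.ext hga) (Subtype.ext hgb)
    ext1 z
    have hz : z ∈ (MulAut.conjNormal g :
        MulAut (alternatingGroup (Fin 5))).toMonoidHom.eqLocus φ.toMonoidHom := by
      rw [htop]; trivial
    exact hz

end AltFiveAut

/-- The automorphism group of the alternating group `A₅` is isomorphic to `Sym(5)`. -/
theorem mulAut_altFive :
    Nonempty (MulAut (alternatingGroup (Fin 5)) ≃* Equiv.Perm (Fin 5)) := by
  exact ⟨(MulEquiv.ofBijective _ AltFiveAut.conj_bijective).symm⟩
end

section
/- Let K be a group with a normal subgroup N of index 2 such that N is isomorphic to the alternating group A₅. Suppose there exists ρ ∈ K with ρ² = 1, ρ ∉ N, and such that the automorphism of N given by conjugation by ρ is not an inner automorphism of N. Then K is isomorphic to Sym(5). -/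
theorem altFive_card_sylow {G : Type*} [Group G] [IsSimpleGroup G] (hc : Nat.card G = 60)
    (a b t : G) (ha : a * a = 1) (hb : b * b = 1) (hab : a * b = b * a) (ha1 : a ≠ 1)
    (hb1 : b ≠ 1) (hne : a ≠ b) (ht : t ^ 3 = 1) (ht1 : t ≠ 1) (h1 : t * a * t⁻¹ = b)
    (h2 : t * b * t⁻¹ = a * b) : Nat.card (Sylow 2 G) = 5 := by
  have : Finite G := Nat.finite_of_card_ne_zero (by omega)
  have : Fact (Nat.Prime 2) := ⟨Nat.prime_two⟩
  have : Fact (Nat.Prime 3) := ⟨Nat.prime_three⟩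
  have hai : a⁻¹ = a := inv_eq_of_mul_eq_one_left ha
  have hbi : b⁻¹ = b := inv_eq_of_mul_eq_one_left hb
  have hab1 : a * b ≠ 1 := fun h => hne (by rw [← hbi]; exact eq_inv_of_mul_eq_one_left h)
  have haab : a * (a * b) = b := by rw [← mul_assoc, ha, one_mul]
  have hbab : b * (a * b) = a := by rw [hab, ← mul_assoc, hb, one_mul]
  have haba : a * b * a = b := by rw [hab, mul_assoc, ha, mul_one]
  have habb : a * b * b = a := by rw [mul_assoc, hb, mul_one]
  have habab : a * b * (a * b) = 1 := by rw [mul_assoc, hbab, ha]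
  let V : Subgroup G :=
    { carrier := {1, a, b, a * b}
      one_mem' := by simp
      mul_mem' := by
        intro x y hx hy
        simp only [Set.mem_insert_iff, Set.mem_singleton_iff] at hx hy ⊢
        rcases hx with rfl | rfl | rfl | rfl <;> rcases hy with rfl | rfl | rfl | rfl <;>
          simp [ha, hb, haab, hbab, haba, habb, habab, ← hab]
      inv_mem' := by
        intro x hx
        simp only [Set.mem_insert_iff, Set.mem_singleton_iff] at hx ⊢
        rcases hx with rfl | rfl | rfl | rfl <;> simp [hai, hbi, ← hab] }
  have hmem : ∀ x, x ∈ V ↔ x = 1 ∨ x = a ∨ x = b ∨ x = a * b := fun x => Iff.rfl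
  have hVc : Nat.card V = 4 := by
    have hs : ((V : Set G)) = {1, a, b, a * b} := rfl
    have : Nat.card V = (V : Set G).ncard := rfl
    classical
    have e : ({1, a, b, a * b} : Set G) = (({1, a, b, a * b} : Finset G) : Set G) := by simp
    rw [this, hs, e, Set.ncard_coe_finset]
    have q1 : a ≠ a * b := fun h => hb1 (by simpa using h)
    have q2 : b ≠ a * b := fun h => ha1 (by simpa using h)
    rw [Finset.card_insert_of_notMem, Finset.card_insert_of_notMem, Finset.card_insert_of_notMem,
      Finset.card_singleton]
    · simpa using ha1
    · simp [hne, hb1]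
    · simp only [Finset.mem_insert, Finset.mem_singleton, not_or]
      exact ⟨ha1.symm, hb1.symm, hab1.symm⟩
  have hcard : Nat.card V = 2 ^ (Nat.card G).factorization 2 := by
    have : (60 : ℕ).factorization 2 = 2 := by
      rw [Nat.factorization_def _ Nat.prime_two]
      have : (60 : ℕ) = 2 ^ 2 * 15 := by norm_num
      rw [this, padicValNat.mul (by norm_num) (by norm_num), padicValNat.prime_pow,
        padicValNat.eq_zero_of_not_dvd (by norm_num)]
    rw [hVc, hc, this]
    norm_num
  let P : Sylow 2 G := Sylow.ofCard V hcard
  have hP : (P : Subgroup G) = V := rfl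
  have htN : t ∈ Subgroup.normalizer (V : Set G) := by
    have h3 : t * (a * b) * t⁻¹ = a := by
      have : t * (a * b) * t⁻¹ = (t * a * t⁻¹) * (t * b * t⁻¹) := by group
      rw [this, h1, h2, hbab]
    have hfor : ∀ x ∈ V, t * x * t⁻¹ ∈ V := by
      intro x hx
      rw [hmem] at hx
      rcases hx with rfl | rfl | rfl | rfl
      · simpa using V.one_mem
      · rw [h1, hmem]; simp
      · rw [h2, hmem]; simp
      · rw [h3, hmem]; simp
    rw [Subgroup.mem_normalizer_iff]
    intro x
    refine ⟨hfor x, fun h => ?_⟩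
    have k := hfor _ (hfor _ h)
    have : t * (t * (t * x * t⁻¹) * t⁻¹) * t⁻¹ = t ^ 3 * x * (t ^ 3)⁻¹ := by
      simp [pow_succ, mul_assoc]
    rw [this, ht] at k
    simpa using k
  set H := Subgroup.normalizer (V : Set G) with hH
  have d4 : 4 ∣ Nat.card H := hVc ▸ Subgroup.card_dvd_of_le (Subgroup.le_normalizer)
  have d3 : 3 ∣ Nat.card H := by
    have := orderOf_dvd_natCard (⟨t, htN⟩ : H)
    rwa [orderOf_eq_prime (p := 3) (by ext; simpa using ht) (by simpa using ht1)] at this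
  have d12 : 12 ∣ Nat.card H := Nat.Coprime.mul_dvd_of_dvd_of_dvd (m := 4) (n := 3) (by norm_num) d4 d3
  have hmul := H.card_mul_index
  rw [Sylow.card_eq_index_normalizer P]
  change H.index = 5
  have hne1 : H.index ≠ 1 := by
    intro h
    rw [Subgroup.index_eq_one] at h
    have hn : V.Normal := Subgroup.normalizer_eq_top_iff.mp h
    rcases hn.eq_bot_or_eq_top with h | h
    · rw [h] at hVc; simp at hVc
    · rw [h] at hVc; simp [hc] at hVc
  obtain ⟨k, hk⟩ := d12
  rw [hk, hc] at hmul
  have : k * H.index = 5 := by nlinarith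
  have hd : H.index ∣ 5 := ⟨k, by rw [mul_comm, this]⟩
  rcases (Nat.dvd_prime Nat.prime_five).1 hd with h | h
  · exact absurd h hne1
  · exact h

theorem altFive_exists_gens : ∃ a b t : alternatingGroup (Fin 5), a * a = 1 ∧ b * b = 1 ∧
    a * b = b * a ∧ a ≠ 1 ∧ b ≠ 1 ∧ a ≠ b ∧ t ^ 3 = 1 ∧ t ≠ 1 ∧ t * a * t⁻¹ = b ∧
    t * b * t⁻¹ = a * b := by
  refine ⟨⟨Equiv.swap 0 1 * Equiv.swap 2 3, Equiv.Perm.mem_alternatingGroup.2 (by decide)⟩, ⟨Equiv.swap 1 2 * Equiv.swap 0 3, Equiv.Perm.mem_alternatingGroup.2 (by decide)⟩,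
    ⟨Equiv.swap 0 1 * Equiv.swap 1 2, Equiv.Perm.mem_alternatingGroup.2 (by decide)⟩, ?_⟩
  decide

/-- If a group `K` has a normal subgroup `N` of index 2 isomorphic to `A₅`, and there is an
involution `ρ ∈ K \ N` whose conjugation action on `N` is not an inner automorphism of `N`,
then `K ≅ Sym(5)`. -/
theorem ext_of_altFive_by_outer_involution (K : Type*) [Group K] (N : Subgroup K)
    [N.Normal] (hidx : N.index = 2) (hN : Nonempty (N ≃* alternatingGroup (Fin 5)))
    (hρ : ∃ ρ : K, ρ ^ 2 = 1 ∧ ρ ∉ N ∧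
      ¬∃ g ∈ N, ∀ x ∈ N, ρ * x * ρ⁻¹ = g * x * g⁻¹) :
    Nonempty (K ≃* Equiv.Perm (Fin 5)) := by
  obtain ⟨e⟩ := hN
  obtain ⟨ρ, -, hρN, hρ⟩ := hρ
  have : Fact (Nat.Prime 2) := ⟨Nat.prime_two⟩
  have hc : Nat.card N = 60 := by
    rw [Nat.card_congr e.toEquiv, nat_card_alternatingGroup]
    simp [Nat.factorial]
  have : IsSimpleGroup (alternatingGroup (Fin 5)) := alternatingGroup.isSimpleGroup_five
  have : IsSimpleGroup N := e.isSimpleGroup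
  have : Finite N := Nat.finite_of_card_ne_zero (by omega)
  have hcK : Nat.card K = 120 := by
    rw [← N.card_mul_index, hc, hidx]
  have : Finite K := Nat.finite_of_card_ne_zero (by omega)
  have h5 : Nat.card (Sylow 2 N) = 5 := by
    obtain ⟨a, b, t, q1, q2, q3, q4, q5, q6, q7, q8, q9, q10⟩ := altFive_exists_gens
    have f := e.symm
    refine altFive_card_sylow hc (f a) (f b) (f t) ?_ ?_ ?_ ?_ ?_ ?_ ?_ ?_ ?_ ?_
    · rw [← map_mul, q1, map_one]
    · rw [← map_mul, q2, map_one]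
    · rw [← map_mul, q3, map_mul]
    · simpa using q4
    · simpa using q5
    · simpa using q6
    · rw [← map_pow, q7, map_one]
    · simpa using q8
    · rw [← map_inv, ← map_mul, ← map_mul, q9]
    · rw [← map_inv, ← map_mul, ← map_mul, q10, map_mul]
  let φ : K →* Equiv.Perm (Sylow 2 N) :=
    (MulAction.toPermHom (MulAut N) (Sylow 2 N)).comp MulAut.conjNormal
  have hNtriv : ∀ n : N, φ n = 1 → n = 1 := by
    have hφ : ∀ (n : N) (P : Sylow 2 N), φ n P = n • P := by
      intro n P
      change (MulAut.conjNormal (n : K) : MulAut N) • P = MulAut.conj n • P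
      congr 1
      ext x
      simp
    have hnorm : ((φ.comp N.subtype).ker).Normal := inferInstance
    rcases hnorm.eq_bot_or_eq_top with h | h
    · intro n hn
      have : n ∈ (φ.comp N.subtype).ker := hn
      rwa [h, Subgroup.mem_bot] at this
    · exfalso
      have : Subsingleton (Sylow 2 N) := by
        refine ⟨fun P Q => ?_⟩
        obtain ⟨n, hn⟩ := MulAction.exists_smul_eq N P Q
        have hk : n ∈ (φ.comp N.subtype).ker := by rw [h]; trivial
        have hk : φ n = 1 := hk
        rw [← hn, ← hφ, hk]
        rfl
      have := Finite.card_le_one_iff_subsingleton.2 this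
      omega
  have hinj : Function.Injective φ := by
    rw [injective_iff_map_eq_one]
    intro m hm
    by_cases hmN : m ∈ N
    · simpa using congrArg Subtype.val (hNtriv ⟨m, hmN⟩ hm)
    · exfalso
      apply hρ
      have hcomm : ∀ x ∈ N, m * x * m⁻¹ = x := by
        intro x hx
        have h1 : m * x * m⁻¹ * x⁻¹ ∈ N :=
          N.mul_mem (Subgroup.Normal.conj_mem inferInstance x hx m) (N.inv_mem hx)
        have h2 : φ (m * x * m⁻¹ * x⁻¹) = 1 := by simp [map_mul, hm]
        have h3 := congrArg Subtype.val (hNtriv ⟨_, h1⟩ h2)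
        exact mul_inv_eq_one.1 h3
      have hmi : m⁻¹ ∉ N := fun h => hmN (by simpa using N.inv_mem h)
      refine ⟨ρ * m⁻¹, (Subgroup.mul_mem_iff_of_index_two hidx).2 (by tauto), fun x hx => ?_⟩
      have := hcomm x hx
      have h4 : x = m⁻¹ * x * m := by
        conv_rhs => rw [← this]
        group
      conv_lhs => rw [h4]
      group
  have hcP : Nat.card (Equiv.Perm (Sylow 2 N)) = 120 := by
    rw [Nat.card_perm, h5]; rfl
  have hbij : Function.Bijective φ :=
    (Nat.bijective_iff_injective_and_card φ).2 ⟨hinj, by rw [hcK, hcP]⟩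
  let ε : Sylow 2 N ≃ Fin 5 := Finite.equivFinOfCardEq h5
  exact ⟨(MulEquiv.ofBijective φ hbij).trans ε.permCongrHom⟩
end

section
/- In the free group F₂ on two generators x, y, the four elements y x y⁻¹, y⁻¹ x y, x y x⁻¹ and x⁻¹ y x freely generate a free subgroup of rank 4; that is, the group homomorphism from the free group on a 4-element set to F₂ sending the four free generators to these four words, respectively, is injective. -/
/-- The generator `x` of the free group `F₂`. -/
def fx : FreeGroup (Fin 2) := FreeGroup.of 0

/-- The generator `y` of the free group `F₂`. -/
def fy : FreeGroup (Fin 2) := FreeGroup.of 1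

/-- Elements whose reduced word starts with the letters `a b`. -/
def startSet (a b : Fin 2 × Bool) : Set (FreeGroup (Fin 2)) :=
  {g | ∃ L, g.toWord = a :: b :: L}

theorem startSet_disjoint {a b c d : Fin 2 × Bool} (h : ¬ (a = c ∧ b = d)) :
    Disjoint (startSet a b) (startSet c d) := by
  rw [Set.disjoint_left]
  rintro g ⟨L, hL⟩ ⟨M, hM⟩
  rw [hL] at hM
  simp only [List.cons.injEq] at hM
  exact h ⟨hM.1, hM.2.1⟩

theorem startSet_key (i j : Fin 2) (s t : Bool) (hij : i ≠ j) (g : FreeGroup (Fin 2))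
    (hg : g ∉ startSet (i, s) (j, !t)) :
    FreeGroup.mk [(i, s), (j, t), (i, !s)] * g ∈ startSet (i, s) (j, t) := by
  have hred := g.reduce_toWord
  have hw : (FreeGroup.mk [(i, s), (j, t), (i, !s)] * g).toWord
      = FreeGroup.reduce ((i, s) :: (j, t) :: (i, !s) :: g.toWord) := by
    conv_lhs => rw [← FreeGroup.mk_toWord (x := g)]
    rw [FreeGroup.mul_mk, FreeGroup.toWord_mk]
    rfl
  simp only [startSet, Set.mem_ofPred_eq] at hg ⊢
  rw [hw]
  simp only [FreeGroup.reduce.cons, hred]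
  rcases hL : g.toWord with _ | ⟨⟨c, p⟩, _ | ⟨⟨d, q⟩, L⟩⟩
  · simp [hij, hij.symm]
  · by_cases h1 : i = c ∧ s = p
    · obtain ⟨rfl, rfl⟩ := h1
      simp [hij]
    · simp [hij, hij.symm, h1]
  · by_cases h1 : i = c ∧ s = p
    · obtain ⟨rfl, rfl⟩ := h1
      have h2 : ¬ (j = d ∧ t = !q) := by
        rintro ⟨rfl, rfl⟩
        exact hg ⟨L, by simp [hL]⟩
      simp [hij, h2]
    · simp [hij, hij.symm, h1]

/-- First indices. -/
def idI : Fin 4 → Fin 2 × Bool := ![(1, true), (1, false), (0, true), (0, false)]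

/-- Second indices. -/
def idJ : Fin 4 → Fin 2 := ![0, 0, 1, 1]

theorem word_eq (k : Fin 4) :
    (![fy * fx * fy⁻¹, fy⁻¹ * fx * fy, fx * fy * fx⁻¹, fx⁻¹ * fy * fx] :
      Fin 4 → FreeGroup (Fin 2)) k
      = FreeGroup.mk [idI k, (idJ k, true), ((idI k).1, !(idI k).2)] := by
  fin_cases k <;> rfl

theorem word_inv_eq (k : Fin 4) :
    ((![fy * fx * fy⁻¹, fy⁻¹ * fx * fy, fx * fy * fx⁻¹, fx⁻¹ * fy * fx] :
      Fin 4 → FreeGroup (Fin 2)) k)⁻¹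
      = FreeGroup.mk [idI k, (idJ k, false), ((idI k).1, !(idI k).2)] := by
  fin_cases k <;> rfl

theorem id_ne (k : Fin 4) : (idI k).1 ≠ idJ k := by
  fin_cases k <;> decide

theorem idI_inj : Function.Injective idI := by decide

/-- In `F₂ = ⟨x, y⟩`, the four words `y x y⁻¹`, `y⁻¹ x y`, `x y x⁻¹`, `x⁻¹ y x` freely
generate a free subgroup of rank 4: the induced homomorphism from the free group on four
generators is injective. -/
theorem four_conjugates_free :
    Function.Injective
      (FreeGroup.lift (![fy * fx * fy⁻¹, fy⁻¹ * fx * fy, fx * fy * fx⁻¹, fx⁻¹ * fy * fx]) :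
        FreeGroup (Fin 4) →* FreeGroup (Fin 2)) := by
  apply FreeGroup.injective_lift_of_ping_pong _
    (X := fun k => startSet (idI k) (idJ k, true))
    (Y := fun k => startSet (idI k) (idJ k, false))
  · intro k
    refine ⟨FreeGroup.mk [idI k, (idJ k, true), ((idI k).1, !(idI k).2)] * 1, ?_⟩
    exact startSet_key _ _ _ _ (id_ne k) 1 (by simp [startSet])
  · intro k l h
    exact startSet_disjoint fun h' => h (idI_inj h'.1)
  · intro k l h
    exact startSet_disjoint fun h' => h (idI_inj h'.1)
  · intro k l
    exact startSet_disjoint fun h' => by simp at h'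
  · rintro k _ ⟨g, hg, rfl⟩
    simp only [smul_eq_mul, word_eq]
    exact startSet_key _ _ _ _ (id_ne k) g hg
  · rintro k _ ⟨g, hg, rfl⟩
    simp only [Pi.inv_apply, smul_eq_mul, word_inv_eq]
    exact startSet_key _ _ _ _ (id_ne k) g hg
end

section
/- Let n ≥ 2 and let F_n be the free group on generators x₁, …, x_n. The 2n(n−1) elements x_j x_i x_j⁻¹ and x_j⁻¹ x_i x_j, for all pairs of indices i ≠ j, freely generate a free subgroup of F_n of rank 2n(n−1); that is, the group homomorphism from the free group on the index set {(i, j, ε) : i, j ∈ {1,…,n}, i ≠ j, ε ∈ {±1}} to F_n sending the generator indexed (i, j, +1) to x_j x_i x_j⁻¹ and the generator indexed (i, j, −1) to x_j⁻¹ x_i x_j is injective. -/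
open FreeGroup in
/-- Elements whose reduced word starts with `u` followed by `v`. -/
def pingSet {α : Type*} [DecidableEq α] (u v : α × Bool) : Set (FreeGroup α) :=
  {g | g ∈ startsWith u ∧ (mk [u])⁻¹ * g ∈ startsWith v}

open FreeGroup in
theorem startsWith_unique {α : Type*} [DecidableEq α] {u v : α × Bool} {g : FreeGroup α}
    (h1 : g ∈ startsWith u) (h2 : g ∈ startsWith v) : u = v := by
  by_contra h
  exact Set.disjoint_left.mp (startsWith.disjoint_iff_ne.mpr h) h1 h2

open FreeGroup in
theorem mk_singleton_inv {α : Type*} (u : α × Bool) :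
    (mk [u])⁻¹ = mk [(u.1, !u.2)] := by
  simp [inv_mk, invRev]

theorem pingSet_disjoint {α : Type*} [DecidableEq α] {u v u' v' : α × Bool}
    (h : ¬ (u = u' ∧ v = v')) : Disjoint (pingSet u v) (pingSet u' v') := by
  rw [Set.disjoint_left]
  rintro g ⟨h1, h2⟩ ⟨h3, h4⟩
  have e := startsWith_unique h1 h3
  subst e
  exact h ⟨rfl, startsWith_unique h2 h4⟩

open FreeGroup in
theorem pingSet_step {α : Type*} [DecidableEq α] {u v : α × Bool} (huv : u.1 ≠ v.1)
    {g : FreeGroup α} (hg : g ∉ pingSet u (v.1, !v.2)) :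
    mk [u] * mk [v] * (mk [u])⁻¹ * g ∈ pingSet u v := by
  have h1 : (mk [u])⁻¹ * g ∉ startsWith (v.1, !v.2) := by
    intro h
    by_cases hu : g ∈ startsWith u
    · exact hg ⟨hu, h⟩
    · have h2 : (mk [u])⁻¹ * g ∈ startsWith (u.1, !u.2) := by
        rw [mk_singleton_inv]
        apply startsWith_mk_mul
        simpa using hu
      have e := startsWith_unique h2 h
      have e2 := congrArg Prod.fst e
      exact huv e2
  have h3 := startsWith_mk_mul _ h1
  have h4 : mk [v] * ((mk [u])⁻¹ * g) ∉ startsWith (u.1, !u.2) := by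
    intro h
    have e := startsWith_unique h h3
    have e2 := congrArg Prod.fst e
    exact huv e2
  have h5 := startsWith_mk_mul _ h4
  refine ⟨by simpa only [mul_assoc] using h5, ?_⟩
  simpa only [mul_assoc, inv_mul_cancel_left] using h3

/-- In `F_n = ⟨x₁, …, x_n⟩` with `n ≥ 2`, the `2n(n−1)` words `x_j x_i x_j⁻¹` and
`x_j⁻¹ x_i x_j` (for `i ≠ j`) freely generate a free subgroup of rank `2n(n−1)`:
the induced homomorphism from the free group on the index set
`{(i,j) : i ≠ j} × {±1}` is injective.  The index `((i,j), true)` is sent to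
`x_j x_i x_j⁻¹` and `((i,j), false)` to `x_j⁻¹ x_i x_j`. -/
theorem conjugate_generators_free (n : ℕ) (hn : 2 ≤ n) :
    Function.Injective
      (FreeGroup.lift
        (fun q : {p : Fin n × Fin n // p.1 ≠ p.2} × Bool =>
          if q.2 then
            FreeGroup.of q.1.1.2 * FreeGroup.of q.1.1.1 * (FreeGroup.of q.1.1.2)⁻¹
          else
            (FreeGroup.of q.1.1.2)⁻¹ * FreeGroup.of q.1.1.1 * FreeGroup.of q.1.1.2) :
        FreeGroup ({p : Fin n × Fin n // p.1 ≠ p.2} × Bool) →* FreeGroup (Fin n)) := by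
  classical
  have : Nontrivial ({p : Fin n × Fin n // p.1 ≠ p.2} × Bool) :=
    ⟨(⟨(⟨0, by omega⟩, ⟨1, by omega⟩), by simp⟩, true),
      (⟨(⟨0, by omega⟩, ⟨1, by omega⟩), by simp⟩, false), by simp⟩
  have key : ∀ q : {p : Fin n × Fin n // p.1 ≠ p.2} × Bool,
      (if q.2 then
            FreeGroup.of q.1.1.2 * FreeGroup.of q.1.1.1 * (FreeGroup.of q.1.1.2)⁻¹
          else
            (FreeGroup.of q.1.1.2)⁻¹ * FreeGroup.of q.1.1.1 * FreeGroup.of q.1.1.2) =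
        FreeGroup.mk [(q.1.1.2, q.2)] * FreeGroup.mk [(q.1.1.1, true)] *
          (FreeGroup.mk [(q.1.1.2, q.2)])⁻¹ := by
    rintro ⟨⟨⟨i, j⟩, h⟩, b⟩
    cases b <;> simp [FreeGroup.of, FreeGroup.inv_mk, FreeGroup.invRev]
  have ext_idx : ∀ q r : {p : Fin n × Fin n // p.1 ≠ p.2} × Bool, ∀ b c : Bool,
      ((q.1.1.2, q.2) = (r.1.1.2, r.2) ∧ (q.1.1.1, b) = (r.1.1.1, c)) → q = r ∧ b = c := by
    rintro ⟨⟨⟨i, j⟩, h⟩, b⟩ ⟨⟨⟨i', j'⟩, h'⟩, b'⟩ d e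
    simp
    tauto
  refine FreeGroup.injective_lift_of_ping_pong _
    (fun q => pingSet (q.1.1.2, q.2) (q.1.1.1, true))
    (fun q => pingSet (q.1.1.2, q.2) (q.1.1.1, false)) ?_ ?_ ?_ ?_ ?_ ?_
  · intro q
    refine ⟨_, pingSet_step (g := 1) (Ne.symm q.1.2) ?_⟩
    rintro ⟨h, -⟩
    exact FreeGroup.startsWith.ne_one _ h rfl
  · intro q r hqr
    exact pingSet_disjoint fun h => hqr (ext_idx q r _ _ h).1
  · intro q r hqr
    exact pingSet_disjoint fun h => hqr (ext_idx q r _ _ h).1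
  · intro q r
    exact pingSet_disjoint fun h => by simpa using (ext_idx q r _ _ h).2
  · rintro q _ ⟨g, hg, rfl⟩
    simp only [key, smul_eq_mul]
    exact pingSet_step (Ne.symm q.1.2) hg
  · rintro q _ ⟨g, hg, rfl⟩
    simp only [Pi.inv_apply, key, smul_eq_mul]
    have h := pingSet_step (u := (q.1.1.2, q.2)) (v := (q.1.1.1, false)) (Ne.symm q.1.2) hg
    have e : FreeGroup.mk [(q.1.1.1, false)] = (FreeGroup.mk [(q.1.1.1, true)])⁻¹ := by
      rw [mk_singleton_inv]; rfl
    rw [e] at h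
    simpa only [mul_inv_rev, inv_inv, mul_assoc] using h
end

section
/- Let F be the free group on a set I with free generators (x_i)_{i ∈ I}. For any two subsets S and T of I, the intersection of the subgroup generated by {x_s : s ∈ S} and the subgroup generated by {x_t : t ∈ T} is the subgroup generated by {x_u : u ∈ S ∩ T}. -/
/-- In a free group, the intersection of two standard parabolic subgroups (subgroups
generated by subsets of the free generators) is the standard parabolic subgroup generated
by the intersection of the two subsets of generators. -/
theorem freeGroup_parabolic_inf (I : Type*) (S T : Set I) :
    Subgroup.closure (FreeGroup.of '' S) ⊓ Subgroup.closure (FreeGroup.of '' T) =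
      Subgroup.closure (FreeGroup.of '' (S ∩ T) : Set (FreeGroup I)) := by
  classical
  apply le_antisymm
  · rintro x ⟨hS, hT⟩
    let r : FreeGroup I →* FreeGroup I :=
      FreeGroup.lift (fun i => if i ∈ T then FreeGroup.of i else 1)
    have h1 : Subgroup.closure (FreeGroup.of '' T) ≤ r.eqLocus (MonoidHom.id _) := by
      rw [Subgroup.closure_le]
      rintro _ ⟨t, ht, rfl⟩
      change r (FreeGroup.of t) = FreeGroup.of t
      simp [r, ht]
    have h2 : Subgroup.closure (FreeGroup.of '' S) ≤
        (Subgroup.closure (FreeGroup.of '' (S ∩ T) : Set (FreeGroup I))).comap r := by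
      rw [Subgroup.closure_le]
      rintro _ ⟨s, hs, rfl⟩
      change r (FreeGroup.of s) ∈ Subgroup.closure _
      by_cases ht : s ∈ T
      · have e : r (FreeGroup.of s) = FreeGroup.of s := by simp [r, ht]
        rw [e]
        exact Subgroup.subset_closure ⟨s, ⟨hs, ht⟩, rfl⟩
      · have e : r (FreeGroup.of s) = 1 := by simp [r, ht]
        rw [e]
        exact one_mem _
    have e : r x = x := h1 hT
    have m : r x ∈ Subgroup.closure (FreeGroup.of '' (S ∩ T) : Set (FreeGroup I)) := h2 hS
    rwa [e] at m
  · exact le_inf (Subgroup.closure_mono (Set.image_mono Set.inter_subset_left))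
      (Subgroup.closure_mono (Set.image_mono Set.inter_subset_right))
end

section
/- Let I be a finite set and F the free group on I with free generators (x_i)_{i ∈ I}. For each i ∈ I let G_i be the subgroup of F generated by {x_k : k ∈ I, k ≠ i}, and for J ⊆ I let G_J = ⋂_{j ∈ J} G_j. Then for every subset J ⊆ I and every i ∈ I \ J, the set product G_J · G_i equals ⋂_{j ∈ J} (G_j · G_i), where for subgroups A, B ≤ F the set product A · B is {a b : a ∈ A, b ∈ B} ⊆ F. -/
open Pointwise
/-- The maximal standard parabolic subgroup of the free group on `I` generated by all free
generators except `x_i`. -/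
def maxParabolic (I : Type*) (i : I) : Subgroup (FreeGroup I) :=
  Subgroup.closure (FreeGroup.of '' {k : I | k ≠ i})

theorem aux_mk_mem {I : Type*} (i : I) (L : List (I × Bool)) (h : ∀ p ∈ L, p.1 ≠ i) :
    FreeGroup.mk L ∈ maxParabolic I i := by
  induction L with
  | nil => exact one_mem _
  | cons p L ih =>
    have e : FreeGroup.mk (p :: L) = FreeGroup.mk [p] * FreeGroup.mk L := by
      rw [FreeGroup.mul_mk]; rfl
    rw [e]
    refine mul_mem ?_ (ih fun q hq => h q (List.mem_cons_of_mem _ hq))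
    have hp : FreeGroup.of p.1 ∈ maxParabolic I i :=
      Subgroup.subset_closure ⟨p.1, h p List.mem_cons_self, rfl⟩
    rcases p with ⟨k, b⟩
    cases b
    · have := inv_mem hp
      rwa [FreeGroup.of, FreeGroup.inv_mk] at this
    · exact hp

theorem aux_word {I : Type*} [DecidableEq I] (i : I) (g : FreeGroup I)
    (hg : g ∈ maxParabolic I i) : ∀ p ∈ g.toWord, p.1 ≠ i := by
  induction hg using Subgroup.closure_induction with
  | mem x hx =>
    obtain ⟨k, hk, rfl⟩ := hx
    intro p hp
    rw [FreeGroup.toWord_of, List.mem_singleton] at hp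
    subst hp
    exact hk
  | one => simp
  | mul x y _ _ hx hy =>
    intro p hp
    rcases List.mem_append.1 ((FreeGroup.toWord_mul_sublist x y).subset hp) with h | h
    · exact hx p h
    · exact hy p h
  | inv x _ hx =>
    intro p hp
    rw [FreeGroup.toWord_inv, FreeGroup.invRev, List.mem_reverse, List.mem_map] at hp
    obtain ⟨q, hq, rfl⟩ := hp
    exact hx q hq

theorem aux_split {I : Type*} (i : I) (L : List (I × Bool)) :
    ∃ u v, L = u ++ v ∧ (∀ p ∈ v, p.1 ≠ i) ∧ (∀ p ∈ u.getLast?, p.1 = i) := by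
  induction L using List.reverseRecOn with
  | nil => exact ⟨[], [], by simp⟩
  | append_singleton L p ih =>
    by_cases hp : p.1 = i
    · exact ⟨L ++ [p], [], by simp, by simp, by simp [hp]⟩
    · obtain ⟨u, v, rfl, hv, hu⟩ := ih
      refine ⟨u, v ++ [p], by simp, ?_, hu⟩
      intro q hq
      rcases List.mem_append.1 hq with h | h
      · exact hv q h
      · rw [List.mem_singleton.1 h]; exact hp

/-- Flag-transitivity criterion for the coset incidence system of the free group over its
maximal standard parabolic subgroups: for every `J ⊆ I` and `i ∉ J`, the set product
`G_J · G_i` equals `⋂_{j ∈ J} (G_j · G_i)`, where `G_J = ⋂_{j ∈ J} G_j`. -/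
theorem freeGroup_flagTransitivity_criterion (I : Type*) [Finite I] (J : Set I) (i : I)
    (hi : i ∉ J) :
    ((⨅ j ∈ J, maxParabolic I j : Subgroup (FreeGroup I)) : Set (FreeGroup I)) *
        (maxParabolic I i : Set (FreeGroup I)) =
      ⋂ j ∈ J, ((maxParabolic I j : Set (FreeGroup I)) *
        (maxParabolic I i : Set (FreeGroup I))) := by
  classical
  apply Set.Subset.antisymm
  · rintro _ ⟨a, ha, b, hb, rfl⟩
    simp only [Set.mem_iInter]
    intro j hj
    have ha' : a ∈ (⨅ j ∈ J, maxParabolic I j : Subgroup (FreeGroup I)) := ha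
    simp only [Subgroup.mem_iInf] at ha'
    exact ⟨a, ha' j hj, b, hb, rfl⟩
  · intro g hg
    simp only [Set.mem_iInter] at hg
    obtain ⟨u, v, huv, hv, hu⟩ := aux_split i g.toWord
    have hvm := aux_mk_mem i v hv
    have hgm : FreeGroup.mk u * FreeGroup.mk v = g := by
      rw [FreeGroup.mul_mk, ← huv, FreeGroup.mk_toWord]
    refine ⟨FreeGroup.mk u, ?_, FreeGroup.mk v, hvm, hgm⟩
    change FreeGroup.mk u ∈ (⨅ j ∈ J, maxParabolic I j : Subgroup (FreeGroup I))
    simp only [Subgroup.mem_iInf]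
    intro j hj
    apply aux_mk_mem
    obtain ⟨a, ha, b, hb, hab⟩ := hg j hj
    have hc : FreeGroup.mk v * b⁻¹ ∈ maxParabolic I i := mul_mem hvm (inv_mem hb)
    generalize hcc : FreeGroup.mk v * b⁻¹ = c at hc
    have hac : a = FreeGroup.mk u * c := by
      rw [← hcc, ← mul_assoc, hgm, ← hab]; simp
    have hcw := aux_word i c hc
    have haw := aux_word j a ha
    have hur : FreeGroup.IsReduced u := by
      have h := FreeGroup.isReduced_toWord (x := g)
      rw [huv] at h
      exact (List.isChain_append.1 h).1
    have hred : FreeGroup.IsReduced (u ++ c.toWord) := by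
      refine List.isChain_append.2 ⟨hur, FreeGroup.isReduced_toWord, ?_⟩
      intro x hx y hy hxy
      exact absurd (hxy ▸ hu x hx) (hcw y (List.mem_of_mem_head? hy))
    have hw : a.toWord = u ++ c.toWord := by
      rw [hac, FreeGroup.toWord_mul, FreeGroup.toWord_mk, hur.reduce_eq, hred.reduce_eq]
    intro p hp
    exact haw p (by rw [hw]; exact List.mem_append_left _ hp)
end
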